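/- arXiv:2506.15257 — 2 statements merged into one kernel-verified Lean document; each statement's English description precedes it below -/
import Mathlib

section
/- Let (a_n) be an arithmetic sequence and (e_n) an arithmetic-type sequence associated with (a_n). Then the subgroup t_{(e_n)}(𝕋) is torsion (every element has finite order) if and only if t_{(e_n)}(𝕋) is countable. -/
open Filter Topology

noncomputable section

/-- The circle group `𝕋 = ℝ/ℤ`. -/
abbrev Circle1 : Type := AddCircle (1 : ℝ)

/-- An arithmetic sequence `(a_n)_{n ≥ 1}`, with the convention `a 0 = 1`:
a strictly increasing sequence of positive integers with `1 < a 1` and `a n ∣ a (n+1)`. -/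
def IsArithSeq (a : ℕ → ℕ) : Prop :=
  a 0 = 1 ∧ StrictMono a ∧ ∀ n, a n ∣ a (n + 1)

/-- The ratio sequence: `q n = a n / a (n-1)` (so `q 1 = a 1`). -/
def ratioSeq (a : ℕ → ℕ) (n : ℕ) : ℕ := a n / a (n - 1)

/-- The subgroup of `𝕋` characterized by a sequence of integers `(u n)`. -/
def charSub (u : ℕ → ℕ) : Set Circle1 :=
  {x : Circle1 | Tendsto (fun n => (u n) • x) atTop (nhds 0)}

/-- The set `{r·a_{k-1} : k ≥ 1, 1 ≤ r ≤ q_k - 1}` whose increasing enumeration is `(d_n)`. -/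
def DSet (a : ℕ → ℕ) : Set ℕ :=
  {m | ∃ k, 1 ≤ k ∧ ∃ r, 1 ≤ r ∧ r ≤ ratioSeq a k - 1 ∧ m = r * a (k - 1)}

/-- `(d_n)` is the strictly increasing enumeration of `DSet a`. -/
def IsDSeq (a d : ℕ → ℕ) : Prop := StrictMono d ∧ Set.range d = DSet a

/-- An arithmetic-type sequence associated with the arithmetic sequence `(a_n)`:
a strictly increasing sequence of positive integers whose set of values contains all the
values `a k` (for `k ≥ 1`) and is contained in `DSet a`. -/
def IsArithTypeSeq (a e : ℕ → ℕ) : Prop :=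
  StrictMono e ∧ (∀ k, 1 ≤ k → a k ∈ Set.range e) ∧ Set.range e ⊆ DSet a

/-- `(c_n)_{n ≥ 1}` is the canonical representation of `x ∈ 𝕋` w.r.t. the arithmetic
sequence `(a_n)`: `0 ≤ c n ≤ q n - 1` for all `n ≥ 1`, `c n < q n - 1` infinitely often,
and `x = Σ_{n ≥ 1} c n / a n` in `𝕋`. -/
def IsCanonicalRep (a c : ℕ → ℕ) (x : Circle1) : Prop :=
  (∀ n, 1 ≤ n → c n ≤ ratioSeq a n - 1) ∧
  {n | 1 ≤ n ∧ c n < ratioSeq a n - 1}.Infinite ∧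
  x = ((∑' n : ℕ, (c (n + 1) : ℝ) / (a (n + 1) : ℝ) : ℝ) : Circle1)

/-- The support of a digit sequence: `supp(x) = {n ≥ 1 : c n ≠ 0}`. -/
def suppOf (c : ℕ → ℕ) : Set ℕ := {n | 1 ≤ n ∧ c n ≠ 0}

theorem IsArithSeq.pos {a : ℕ → ℕ} (ha : IsArithSeq a) (k : ℕ) : 0 < a k :=
  lt_of_lt_of_le (by rw [ha.1]; exact one_pos) (ha.2.1.monotone (Nat.zero_le k))

theorem IsArithSeq.dvd_of_le {a : ℕ → ℕ} (ha : IsArithSeq a) {i j : ℕ} (h : i ≤ j) :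
    a i ∣ a j := by
  induction j, h using Nat.le_induction with
  | base => exact dvd_rfl
  | succ j _ ih => exact ih.trans (ha.2.2 j)

theorem IsArithSeq.two_pow_mul_le {a : ℕ → ℕ} (ha : IsArithSeq a) (i j : ℕ) :
    2 ^ j * a i ≤ a (i + j) := by
  induction j with
  | zero => simp
  | succ j ih =>
    obtain ⟨c, hc⟩ := ha.2.2 (i + j)
    have hlt : a (i + j) < a (i + j + 1) := ha.2.1 (Nat.lt_succ_self _)
    have hc2 : 2 ≤ c := by
      by_contra! h
      interval_cases c <;> omega
    calc 2 ^ (j + 1) * a i = 2 ^ j * a i * 2 := by ring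
      _ ≤ a (i + j) * c := Nat.mul_le_mul ih hc2
      _ = a (i + (j + 1)) := hc.symm

theorem exists_dvd_lt_of_mem_DSet {a : ℕ → ℕ} (ha : IsArithSeq a) {m : ℕ} (hm : m ∈ DSet a) :
    ∃ k, a k ∣ m ∧ m < a (k + 1) := by
  obtain ⟨k, hk, r, hr1, hr, rfl⟩ := hm
  obtain ⟨k, rfl⟩ := Nat.exists_eq_add_of_le' hk
  simp only [ratioSeq, Nat.add_sub_cancel] at hr ⊢
  refine ⟨k, Dvd.intro_left r rfl, ?_⟩
  calc r * a k < a (k + 1) / a k * a k := Nat.mul_lt_mul_of_pos_right (by omega) (ha.pos k)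
    _ = a (k + 1) := Nat.div_mul_cancel (ha.2.2 k)

theorem nsmul_coe_circle (m : ℕ) (X : ℝ) : m • (X : Circle1) = ((m * X : ℝ) : Circle1) := by
  rw [← nsmul_eq_mul]; rfl

/-- The error in approximating `X` by the nearest multiple of `1 / a k`. -/
def approxError (a : ℕ → ℕ) (X : ℝ) (k : ℕ) : ℝ := X - round (a k * X) / a k

theorem mul_abs_approxError {a : ℕ → ℕ} (ha : IsArithSeq a) (X : ℝ) (k : ℕ) :
    a k * |approxError a X k| = ‖a k • (X : Circle1)‖ := by
  have h0 : (0 : ℝ) < a k := by exact_mod_cast ha.pos k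
  rw [nsmul_coe_circle, UnitAddCircle.norm_eq, approxError, ← abs_of_pos h0, ← abs_mul, abs_of_pos h0]
  congr 1
  field_simp

theorem exists_int_mul_approxError {a : ℕ → ℕ} (ha : IsArithSeq a) (X : ℝ) {i m : ℕ}
    (h : a i ∣ m) : ∃ z : ℤ, m * approxError a X i = m * X + z := by
  obtain ⟨c, rfl⟩ := h
  have h0 : (a i : ℝ) ≠ 0 := by exact_mod_cast (ha.pos i).ne'
  refine ⟨-(c * round (a i * X)), ?_⟩
  simp only [approxError]
  push_cast
  field_simp
  ring

theorem mul_abs_approxError_le {a : ℕ → ℕ} (ha : IsArithSeq a) (X : ℝ) {k j m : ℕ} {δ : ℝ}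
    (hm : m ≤ a k) (hδ : ‖a (k + j) • (X : Circle1)‖ ≤ δ) :
    m * |approxError a X (k + j)| ≤ δ * (1 / 2) ^ j := by
  rw [← mul_abs_approxError ha] at hδ
  have h2 : (2 : ℝ) ^ j * a k ≤ a (k + j) := by exact_mod_cast ha.two_pow_mul_le k j
  have hm' : (m : ℝ) ≤ a k := by exact_mod_cast hm
  rw [one_div, inv_pow, ← div_eq_mul_inv, le_div_iff₀ (by positivity)]
  calc m * |approxError a X (k + j)| * 2 ^ j
      ≤ a k * |approxError a X (k + j)| * 2 ^ j := by gcongr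
    _ = 2 ^ j * a k * |approxError a X (k + j)| := by ring
    _ ≤ a (k + j) * |approxError a X (k + j)| := by gcongr
    _ ≤ δ := hδ

theorem norm_circle_le_half (x : Circle1) : ‖x‖ ≤ 1 / 2 := by
  simpa using AddCircle.norm_le_half_period (1 : ℝ) (x := x) one_ne_zero

theorem abs_approxError_le {a : ℕ → ℕ} (ha : IsArithSeq a) (X : ℝ) (j : ℕ) :
    |approxError a X j| ≤ (1 / 2) * (1 / 2) ^ j := by
  simpa using mul_abs_approxError_le ha X (k := 0) (j := j) (m := 1) (ha.pos 0)
    (norm_circle_le_half _)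

/-- The `i`-th term `approxError a X i - approxError a X (i + 1)` of the telescoping expansion
of `X`, kept only when `ε i` holds. -/
def selectedTerm (a : ℕ → ℕ) (X : ℝ) (ε : ℕ → Bool) (i : ℕ) : ℝ :=
  if ε i then approxError a X i - approxError a X (i + 1) else 0

theorem abs_selectedTerm_le (a : ℕ → ℕ) (X : ℝ) (ε : ℕ → Bool) (i : ℕ) :
    |selectedTerm a X ε i| ≤ |approxError a X i| + |approxError a X (i + 1)| := by
  unfold selectedTerm
  split_ifs
  · exact abs_sub _ _
  · simpa using by positivity

theorem abs_selectedTerm_le_geometric {a : ℕ → ℕ} (ha : IsArithSeq a) (X : ℝ) (ε : ℕ → Bool)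
    (i : ℕ) : |selectedTerm a X ε i| ≤ (1 / 2 : ℝ) ^ i := by
  have h1 := abs_approxError_le ha X i
  have h2 := abs_approxError_le ha X (i + 1)
  have h3 : (0 : ℝ) < (1 / 2) ^ i := by positivity
  rw [pow_succ] at h2
  linarith [abs_selectedTerm_le a X ε i]

theorem summable_selectedTerm {a : ℕ → ℕ} (ha : IsArithSeq a) (X : ℝ) (ε : ℕ → Bool) :
    Summable (selectedTerm a X ε) :=
  Summable.of_norm_bounded summable_geometric_two fun i => abs_selectedTerm_le_geometric ha X ε i

/-- The sum of the terms of the telescoping expansion of `X` selected by `ε`. -/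
def selectedSum (a : ℕ → ℕ) (X : ℝ) (ε : ℕ → Bool) : ℝ := ∑' i, selectedTerm a X ε i

theorem continuous_selectedSum {a : ℕ → ℕ} (ha : IsArithSeq a) (X : ℝ) :
    Continuous (selectedSum a X) := by
  refine continuous_tsum (fun i => ?_) summable_geometric_two
    fun i ε => abs_selectedTerm_le_geometric ha X ε i
  exact (continuous_of_discreteTopology (f := fun b : Bool =>
    if b then approxError a X i - approxError a X (i + 1) else 0)).comp (continuous_apply i)

theorem exists_int_mul_selectedTerm {a : ℕ → ℕ} (ha : IsArithSeq a) (X : ℝ) (ε : ℕ → Bool)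
    {i m : ℕ} (h : a (i + 1) ∣ m) : ∃ z : ℤ, m * selectedTerm a X ε i = z := by
  obtain ⟨z, hz⟩ := exists_int_mul_approxError ha X ((ha.2.2 i).trans h)
  obtain ⟨w, hw⟩ := exists_int_mul_approxError ha X h
  unfold selectedTerm
  split_ifs
  · exact ⟨z - w, by rw [mul_sub, hz, hw]; push_cast; ring⟩
  · exact ⟨0, by simp⟩

theorem coe_int_circle (z : ℤ) : ((z : ℝ) : Circle1) = 0 :=
  AddCircle.coe_eq_zero_iff 1 |>.2 ⟨z, by simp⟩

theorem norm_coe_circle_le (r : ℝ) : ‖(r : Circle1)‖ ≤ |r| := by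
  rw [UnitAddCircle.norm_eq]
  simpa using round_le r 0

theorem norm_mul_selectedTerm_le {a : ℕ → ℕ} (ha : IsArithSeq a) (X : ℝ) (ε : ℕ → Bool)
    {k m : ℕ} {δ : ℝ} (hdvd : a k ∣ m) (hlt : m < a (k + 1))
    (hδ : ‖a (k + 1) • (X : Circle1)‖ ≤ δ) :
    ‖((m * selectedTerm a X ε k : ℝ) : Circle1)‖ ≤ ‖m • (X : Circle1)‖ + δ := by
  have hδ0 : 0 ≤ δ := (norm_nonneg _).trans hδ
  unfold selectedTerm
  split_ifs
  · obtain ⟨z, hz⟩ := exists_int_mul_approxError ha X hdvd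
    rw [mul_sub, hz, AddCircle.coe_sub, AddCircle.coe_add, coe_int_circle, add_zero,
      nsmul_coe_circle]
    refine (norm_sub_le _ _).trans ?_
    gcongr
    refine (norm_coe_circle_le _).trans ?_
    rw [abs_mul, Nat.abs_cast]
    simpa using mul_abs_approxError_le ha X (k := k + 1) (j := 0) hlt.le hδ
  · simp only [mul_zero, AddCircle.coe_zero, norm_zero]
    positivity

theorem norm_nsmul_selectedSum_le {a : ℕ → ℕ} (ha : IsArithSeq a) (X : ℝ) (ε : ℕ → Bool)
    {k m : ℕ} {δ : ℝ} (hdvd : a k ∣ m) (hlt : m < a (k + 1))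
    (hδ : ∀ i, k < i → ‖a i • (X : Circle1)‖ ≤ δ) :
    ‖m • (selectedSum a X ε : Circle1)‖ ≤ ‖m • (X : Circle1)‖ + 4 * δ := by
  have hS := summable_selectedTerm ha X ε
  have hhead : ∃ z : ℤ, m * ∑ i ∈ Finset.range k, selectedTerm a X ε i = z := by
    have h : ∀ i ∈ Finset.range k, ∃ z : ℤ, m * selectedTerm a X ε i = z := fun i hi =>
      exists_int_mul_selectedTerm ha X ε
        ((ha.dvd_of_le (Nat.succ_le_of_lt (Finset.mem_range.1 hi))).trans hdvd)
    choose! z hz using h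
    exact ⟨∑ i ∈ Finset.range k, z i, by
      rw [Finset.mul_sum, Finset.sum_congr rfl hz]; push_cast; rfl⟩
  obtain ⟨z, hz⟩ := hhead
  set R := ∑' i, selectedTerm a X ε (i + (k + 1)) with hR
  have htail : |m * R| ≤ 3 * δ := by
    rw [hR, ← tsum_mul_left]
    have hb : HasSum (fun i : ℕ => 3 / 2 * δ * (1 / 2 : ℝ) ^ i) (3 / 2 * δ * 2) :=
      hasSum_geometric_two.mul_left _
    rw [show 3 * δ = 3 / 2 * δ * 2 by ring, ← Real.norm_eq_abs]
    refine tsum_of_norm_bounded hb fun i => ?_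
    have h1 := mul_abs_approxError_le ha X (k := k + 1) (j := i) hlt.le (hδ _ (by omega))
    have h2 := mul_abs_approxError_le ha X (k := k + 1) (j := i + 1) hlt.le (hδ _ (by omega))
    have h3 := mul_le_mul_of_nonneg_left (abs_selectedTerm_le a X ε (k + 1 + i))
      (Nat.cast_nonneg (α := ℝ) m)
    rw [Real.norm_eq_abs, abs_mul, Nat.abs_cast, add_comm i]
    rw [← add_assoc, pow_succ] at h2
    linarith
  have hsum : m * selectedSum a X ε = z + m * selectedTerm a X ε k + m * R := by
    rw [selectedSum, ← hS.sum_add_tsum_nat_add (k + 1), Finset.sum_range_succ, mul_add, mul_add, hz]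
  rw [nsmul_coe_circle m (selectedSum a X ε), hsum, AddCircle.coe_add, AddCircle.coe_add,
    coe_int_circle, zero_add]
  have h2 := norm_mul_selectedTerm_le ha X ε hdvd hlt (hδ _ (Nat.lt_succ_self k))
  have h3 := (norm_coe_circle_le (m * R)).trans htail
  linarith [norm_add_le ((m * selectedTerm a X ε k : ℝ) : Circle1) ((m * R : ℝ) : Circle1)]

theorem selectedSum_mem_charSub {a e : ℕ → ℕ} (ha : IsArithSeq a) (he : IsArithTypeSeq a e)
    {X : ℝ} (hX : (X : Circle1) ∈ charSub e) (ε : ℕ → Bool) :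
    (selectedSum a X ε : Circle1) ∈ charSub e := by
  obtain ⟨hmono, hsub, hsup⟩ := he
  simp only [charSub, Set.mem_ofPred_eq, Metric.tendsto_atTop, dist_zero_right] at hX ⊢
  intro η hη
  obtain ⟨N, hN⟩ := hX (η / 5) (by positivity)
  have hδ : ∀ i, e N < i → ‖a i • (X : Circle1)‖ ≤ η / 5 := by
    intro i hi
    obtain ⟨n, hn⟩ := hsub i (by omega)
    rw [← hn]
    refine (hN n (hmono.le_iff_le.1 ?_)).le
    rw [hn]
    exact hi.le.trans (ha.2.1.le_apply)
  refine ⟨max N (a (e N)), fun n hn => ?_⟩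
  obtain ⟨k, hk, hlt⟩ := exists_dvd_lt_of_mem_DSet ha (hsup ⟨n, rfl⟩)
  have hk' : e N < k + 1 := by
    refine ha.2.1.lt_iff_lt.1 (lt_of_le_of_lt ?_ hlt)
    exact (le_max_right _ _).trans (hn.trans hmono.le_apply)
  have := norm_nsmul_selectedSum_le ha X ε hk hlt fun i hi => hδ i (by omega)
  linarith [hN n ((le_max_left _ _).trans hn)]

theorem hasSum_approxError_sub {a : ℕ → ℕ} (ha : IsArithSeq a) (X : ℝ) (N : ℕ) :
    HasSum (fun i => approxError a X (i + N) - approxError a X (i + 1 + N))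
      (approxError a X N) := by
  have h0 : Tendsto (approxError a X) atTop (𝓝 0) := by
    refine squeeze_zero_norm (abs_approxError_le ha X) ?_
    have := (tendsto_pow_atTop_nhds_zero_of_lt_one (r := (1 / 2 : ℝ)) (by norm_num)
      (by norm_num)).const_mul (1 / 2 : ℝ)
    rwa [mul_zero] at this
  have hs : Summable fun i => approxError a X (i + N) - approxError a X (i + 1 + N) := by
    have := (summable_nat_add_iff N).2 (summable_selectedTerm ha X fun _ => true)
    simpa [selectedTerm, add_right_comm] using this
  rw [hs.hasSum_iff_tendsto_nat]
  have := (h0.comp (tendsto_add_atTop_nat N)).const_sub (approxError a X N)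
  simpa [Finset.sum_range_sub' (fun i => approxError a X (i + N))] using this

theorem selectedSum_sub_selectedSum {a : ℕ → ℕ} (ha : IsArithSeq a) (X : ℝ) {N : ℕ}
    {ε ε' : ℕ → Bool} (hlt : ∀ i < N, ε i = ε' i) (hge : ∀ i, N ≤ i → ε i = true)
    (hge' : ∀ i, N ≤ i → ε' i = false) :
    selectedSum a X ε - selectedSum a X ε' = approxError a X N := by
  rw [selectedSum, selectedSum, ← (summable_selectedTerm ha X ε).sum_add_tsum_nat_add N,
    ← (summable_selectedTerm ha X ε').sum_add_tsum_nat_add N]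
  have h1 : ∑ i ∈ Finset.range N, selectedTerm a X ε i =
      ∑ i ∈ Finset.range N, selectedTerm a X ε' i :=
    Finset.sum_congr rfl fun i hi => by simp [selectedTerm, hlt i (Finset.mem_range.1 hi)]
  have h2 : ∀ i, selectedTerm a X ε (i + N) =
      approxError a X (i + N) - approxError a X (i + 1 + N) := fun i => by
    simp [selectedTerm, hge, add_right_comm]
  have h3 : ∀ i, selectedTerm a X ε' (i + N) = 0 := fun i => by simp [selectedTerm, hge']
  simp only [h1, h2, h3, tsum_zero, (hasSum_approxError_sub ha X N).tsum_eq]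
  ring

/-- A countable-range continuous function on Cantor space is constant on some cylinder. -/
theorem exists_cylinder_of_countable_range {Y : Type*} [TopologicalSpace Y] [T1Space Y]
    {f : (ℕ → Bool) → Y} (hf : Continuous f) (hc : (Set.range f).Countable) :
    ∃ (ε : ℕ → Bool) (N : ℕ), ∀ ε', (∀ i < N, ε' i = ε i) → f ε' = f ε := by
  have := hc.to_subtype
  obtain ⟨y, ε, hε⟩ := nonempty_interior_of_iUnion_of_closed
    (f := fun y : Set.range f => f ⁻¹' {y.1}) (fun y => isClosed_singleton.preimage hf)
    (Set.eq_univ_of_forall fun ε => Set.mem_iUnion.2 ⟨⟨f ε, ε, rfl⟩, rfl⟩)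
  obtain ⟨_, ⟨η, N, rfl⟩, hη, hsub⟩ := PiNat.isTopologicalBasis_cylinders (fun _ : ℕ => Bool)
    |>.mem_nhds_iff.1 (mem_interior_iff_mem_nhds.1 hε)
  rw [← PiNat.mem_cylinder_iff_eq.1 hη] at hsub
  refine ⟨ε, N, fun ε' h => ?_⟩
  have h1 : f ε' = y.1 := hsub h
  have h2 : ε ∈ f ⁻¹' {y.1} := interior_subset hε
  exact h1.trans (Set.mem_singleton_iff.1 h2).symm

theorem countable_setOf_isOfFinAddOrder_circle : {x : Circle1 | IsOfFinAddOrder x}.Countable := by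
  refine (Set.countable_range fun r : ℚ => ((r : ℝ) : Circle1)).mono fun x hx => ?_
  induction x using QuotientAddGroup.induction_on with
  | H X =>
    obtain ⟨n, hn, h⟩ := isOfFinAddOrder_iff_nsmul_eq_zero.1 hx
    obtain ⟨z, hz⟩ := (AddCircle.coe_eq_zero_iff 1).1 ((nsmul_coe_circle n X).symm.trans h)
    refine ⟨z / n, congrArg _ ?_⟩
    have hn0 : (n : ℝ) ≠ 0 := by exact_mod_cast hn.ne'
    push_cast
    rw [div_eq_iff hn0]
    simp only [zsmul_eq_mul, mul_one] at hz
    linarith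

theorem isOfFinAddOrder_of_approxError_eq_zero {a : ℕ → ℕ} (ha : IsArithSeq a) {X : ℝ} {N : ℕ}
    (h : (approxError a X N : Circle1) = 0) : IsOfFinAddOrder (X : Circle1) := by
  refine isOfFinAddOrder_iff_nsmul_eq_zero.2 ⟨a N, ha.pos N, ?_⟩
  obtain ⟨z, hz⟩ := exists_int_mul_approxError ha X (dvd_refl (a N))
  rw [nsmul_coe_circle, eq_sub_of_add_eq hz.symm, AddCircle.coe_sub, coe_int_circle,
    ← nsmul_coe_circle, h, smul_zero, sub_zero]

/-- `t_{(e_n)}(𝕋)` is torsion iff it is countable. -/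
theorem charSub_torsion_iff_countable (a e : ℕ → ℕ) (ha : IsArithSeq a)
    (he : IsArithTypeSeq a e) :
    (∀ x ∈ charSub e, IsOfFinAddOrder x) ↔ (charSub e).Countable := by
  refine ⟨fun h => countable_setOf_isOfFinAddOrder_circle.mono h, fun hc x hx => ?_⟩
  induction x using QuotientAddGroup.induction_on with
  | H X =>
    obtain ⟨ε, N, h⟩ := exists_cylinder_of_countable_range
      (f := fun ε => (selectedSum a X ε : Circle1))
      ((AddCircle.continuous_mk' 1).comp (continuous_selectedSum ha X))
      (hc.mono (Set.range_subset_iff.2 (selectedSum_mem_charSub ha he hx)))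
    refine isOfFinAddOrder_of_approxError_eq_zero ha (N := N) ?_
    rw [← selectedSum_sub_selectedSum ha X (N := N) (ε := fun i => if i < N then ε i else true)
      (ε' := fun i => if i < N then ε i else false) (fun i hi => by simp [hi])
      (fun i hi => by simp [hi.not_gt]) (fun i hi => by simp [hi.not_gt]), AddCircle.coe_sub,
      sub_eq_zero]
    exact (h _ fun i hi => by simp [hi]).trans (h _ fun i hi => by simp [hi]).symm
end
end

section
/- Let γ ∈ (0,1) be an irrational real number and let ⟨γ mod ℤ⟩ denote the cyclic subgroup of 𝕋 generated by the image of γ. Then there is no arithmetic sequence (a_n) and arithmetic-type sequence (e_n) associated with it such that ⟨γ mod ℤ⟩ = t_{(e_n)}(𝕋). -/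
open Filter Topology

noncomputable section

/-- Every element of `DSet a` that is at least `a 1` is a multiple of `a 1`. -/
theorem dvd_of_mem_DSet {a : ℕ → ℕ} (ha : IsArithSeq a) {m : ℕ} (hm : m ∈ DSet a)
    (hle : a 1 ≤ m) : a 1 ∣ m := by
  obtain ⟨h0, -, hdvd⟩ := ha
  obtain ⟨k, hk, r, hr1, hr, rfl⟩ := hm
  rcases Nat.lt_or_ge k 2 with h | h
  · obtain rfl : k = 1 := by omega
    simp only [ratioSeq, Nat.sub_self, h0, Nat.div_one, mul_one] at hr hle
    omega
  · obtain ⟨j, rfl⟩ := Nat.exists_eq_add_of_le' h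
    refine Dvd.dvd.mul_left ?_ r
    change a 1 ∣ a (j + 1)
    clear * - hdvd
    induction j with
    | zero => exact dvd_rfl
    | succ n ih => exact ih.trans (hdvd (n + 1))

/-- A subgroup characterized by an arithmetic-type sequence contains the torsion element
`1 / a 1`. -/
theorem inv_mem_charSub {a e : ℕ → ℕ} (ha : IsArithSeq a) (he : IsArithTypeSeq a e) :
    (((a 1 : ℝ)⁻¹ : ℝ) : Circle1) ∈ charSub e := by
  have hpos : (a 1 : ℝ) ≠ 0 := by
    have := ha.2.1 Nat.zero_lt_one
    exact_mod_cast (by omega : a 1 ≠ 0)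
  refine tendsto_const_nhds.congr' ?_
  filter_upwards [eventually_ge_atTop (a 1)] with n hn
  obtain ⟨c, hc⟩ :=
    dvd_of_mem_DSet ha (he.2.2 (Set.mem_range_self n)) (hn.trans (he.1.le_apply))
  rw [hc, ← AddCircle.coe_nsmul, eq_comm, AddCircle.coe_eq_zero_iff]
  refine ⟨c, ?_⟩
  simp only [zsmul_eq_mul, nsmul_eq_mul]
  push_cast
  field_simp

/-- the cyclic subgroup of `𝕋` generated by an irrational `γ ∈ (0,1)` cannot be
characterized by any arithmetic-type sequence. -/
theorem irrational_cyclic_not_characterized (γ : ℝ) (hγ : γ ∈ Set.Ioo (0 : ℝ) 1)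
    (hirr : Irrational γ) :
    ¬ ∃ (a e : ℕ → ℕ), IsArithSeq a ∧ IsArithTypeSeq a e ∧
      (AddSubgroup.zmultiples ((γ : Circle1)) : Set Circle1) = charSub e := by
  rintro ⟨a, e, ha, he, heq⟩
  have hx := inv_mem_charSub ha he
  rw [← heq] at hx
  obtain ⟨n, hn⟩ := AddSubgroup.mem_zmultiples_iff.1 hx
  have h1 : 1 < a 1 := by simpa only [ha.1] using ha.2.1 Nat.zero_lt_one
  have hpos : (a 1 : ℝ) ≠ 0 := by exact_mod_cast (by omega : a 1 ≠ 0)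
  rw [← AddCircle.coe_zsmul, ← sub_eq_zero, ← AddCircle.coe_sub,
    AddCircle.coe_eq_zero_iff] at hn
  obtain ⟨z, hz⟩ := hn
  simp only [zsmul_eq_mul, mul_one] at hz
  rcases eq_or_ne n 0 with rfl | hn0
  · have h2 : (z : ℝ) * a 1 = -1 := by
      rw [hz]
      field_simp
      simp
    have h3 : z * (a 1 : ℤ) = -1 := by exact_mod_cast h2
    have h4 : (a 1 : ℤ) ∣ 1 := ⟨-z, by linarith⟩
    have := Int.le_of_dvd one_pos h4
    omega
  · refine (hirr.intCast_mul hn0).ne_rat ((z : ℚ) + (a 1 : ℚ)⁻¹) ?_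
    push_cast
    linarith
end
end
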